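/- arXiv:0807.4802 — 3 statements merged into one kernel-verified Lean document; each statement's English description precedes it below -/
import Mathlib

section
/- Let S ⊆ ℤ² be a nonempty finite set, let P = conv(S) ⊆ ℝ² be its convex hull, and for n ∈ ℕ let n•P = {n·p : p ∈ P} denote the n-th dilate of P. Then for every integer n ≥ 1 one has (n•P) ∩ ℤ² = {p₁ + ⋯ + pₙ : p₁, …, pₙ ∈ P ∩ ℤ²}; in particular, every lattice point of n•P is a sum of n lattice points of P. -/
open Pointwise

/-- The inclusion of the lattice `ℤ²` into the plane. -/
def latticeEmb (z : ℤ × ℤ) : ℝ × ℝ := ((z.1 : ℝ), (z.2 : ℝ))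

lemma latticeEmb_add (z w : ℤ × ℤ) : latticeEmb (z + w) = latticeEmb z + latticeEmb w := by
  simp [latticeEmb]

lemma latticeEmb_sub (z w : ℤ × ℤ) : latticeEmb (z - w) = latticeEmb z - latticeEmb w := by
  simp [latticeEmb]

/-- Twice the signed area of a lattice triangle. -/
def triangleDet (u v w : ℤ × ℤ) : ℤ :=
  (v.1 - u.1) * (w.2 - u.2) - (v.2 - u.2) * (w.1 - u.1)

lemma triangleDet_rotate (u v w : ℤ × ℤ) : triangleDet v w u = triangleDet u v w := by
  unfold triangleDet; ring

/-- Reflecting a point with barycentric weights `a`, `b`, `c` of sum two through the vertices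
scales the area of the triangle by `1 - a` when the reflected point replaces the first vertex. -/
lemma triangleDet_reflect {u v w z : ℤ × ℤ} {a b c : ℝ} (habc : a + b + c = 2)
    (hz : latticeEmb z = a • latticeEmb u + b • latticeEmb v + c • latticeEmb w) :
    (triangleDet (u + v + w - z) v w : ℝ) = (1 - a) * triangleDet u v w := by
  obtain rfl : c = 2 - a - b := by linarith
  simp only [latticeEmb, Prod.ext_iff, Prod.fst_add, Prod.snd_add, Prod.smul_fst, Prod.smul_snd,
    smul_eq_mul] at hz
  obtain ⟨h1, h2⟩ := hz
  simp only [triangleDet, Prod.fst_add, Prod.snd_add, Prod.fst_sub, Prod.snd_sub]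
  push_cast
  rw [h1, h2]
  ring

lemma Convex.add_three_mem {P : Set (ℝ × ℝ)} (hP : Convex ℝ P) {x y z : ℝ × ℝ}
    (hx : x ∈ P) (hy : y ∈ P) (hz : z ∈ P) {a b c : ℝ} (ha : 0 ≤ a) (hb : 0 ≤ b) (hc : 0 ≤ c)
    (h : a + b + c = 1) : a • x + b • y + c • z ∈ P := by
  have := hP.sum_mem (t := Finset.univ) (w := ![a, b, c]) (z := ![x, y, z])
    (by simp [Fin.forall_fin_succ, ha, hb, hc]) (by simp [Fin.sum_univ_three, h])
    (by simp [Fin.forall_fin_succ, hx, hy, hz])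
  simpa [Fin.sum_univ_three] using this

/-- A lattice point in the second dilate of a nondegenerate lattice triangle is a sum of two
lattice points of any convex set containing the triangle. -/
lemma exists_lattice_sub_mem_of_triangle {P : Set (ℝ × ℝ)} (hP : Convex ℝ P) (z : ℤ × ℤ)
    (u v w : ℤ × ℤ) (a b c : ℝ) (hu : latticeEmb u ∈ P) (hv : latticeEmb v ∈ P)
    (hw : latticeEmb w ∈ P) (ha : 0 ≤ a) (hb : 0 ≤ b) (hc : 0 ≤ c) (habc : a + b + c = 2)
    (hz : latticeEmb z = a • latticeEmb u + b • latticeEmb v + c • latticeEmb w)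
    (hD : triangleDet u v w ≠ 0) :
    ∃ p : ℤ × ℤ, latticeEmb p ∈ P ∧ latticeEmb (z - p) ∈ P := by
  induction hN : (triangleDet u v w).natAbs using Nat.strong_induction_on
    generalizing u v w a b c with
  | _ N ih =>
  have min_first : ∀ (u v w : ℤ × ℤ) (a b c : ℝ), latticeEmb u ∈ P → latticeEmb v ∈ P →
      latticeEmb w ∈ P → 0 ≤ a → 0 ≤ b → 0 ≤ c → a + b + c = 2 →
      latticeEmb z = a • latticeEmb u + b • latticeEmb v + c • latticeEmb w →
      triangleDet u v w ≠ 0 → (triangleDet u v w).natAbs = N → a ≤ b → a ≤ c →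
      ∃ p : ℤ × ℤ, latticeEmb p ∈ P ∧ latticeEmb (z - p) ∈ P := by
    intro u v w a b c hu hv hw ha hb hc habc hz hD hN hab hac
    by_cases hb1 : 1 ≤ b
    · refine ⟨v, hv, ?_⟩
      have := hP.add_three_mem hu hv hw ha (sub_nonneg.2 hb1) hc (by linarith)
      convert this using 1
      rw [latticeEmb_sub, hz]
      module
    by_cases hc1 : 1 ≤ c
    · refine ⟨w, hw, ?_⟩
      have := hP.add_three_mem hu hv hw ha hb (sub_nonneg.2 hc1) (by linarith)
      convert this using 1
      rw [latticeEmb_sub, hz]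
      module
    push Not at hb1 hc1
    have ha0 : 0 < a := by linarith
    have ha1 : 0 < 1 - a := by linarith
    have hq : latticeEmb (u + v + w - z) =
        (1 - a) • latticeEmb u + (1 - b) • latticeEmb v + (1 - c) • latticeEmb w := by
      rw [latticeEmb_sub, latticeEmb_add, latticeEmb_add, hz]
      module
    have hqP : latticeEmb (u + v + w - z) ∈ P := by
      rw [hq]
      exact hP.add_three_mem hu hv hw ha1.le (by linarith) (by linarith) (by linarith)
    have hdet := triangleDet_reflect habc hz
    have hD' : (triangleDet u v w : ℝ) ≠ 0 := by exact_mod_cast hD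
    have ht : a / (1 - a) * (1 - a) = a := div_mul_cancel₀ _ ha1.ne'
    have ht0 : 0 ≤ a / (1 - a) := by positivity
    generalize a / (1 - a) = t at ht ht0
    have hcoef : ∀ d, a ≤ d → 0 ≤ d - t * (1 - d) := by
      intro d hd
      nlinarith [mul_le_mul_of_nonneg_left (sub_le_sub_left hd 1) ht0]
    refine ih _ ?_ (u + v + w - z) v w t (b - t * (1 - b)) (c - t * (1 - c)) hqP hv hw ht0
      (hcoef b hab) (hcoef c hac) ?_ ?_ ?_ rfl
    · rw [← hN]
      have : |(triangleDet (u + v + w - z) v w : ℝ)| < |(triangleDet u v w : ℝ)| := by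
        rw [hdet, abs_mul, abs_of_pos ha1]
        nlinarith [abs_pos.2 hD']
      rw [← Int.cast_abs, ← Int.cast_abs, Int.cast_lt] at this
      zify
      exact this
    · linear_combination (1 + t) * habc + ht
    · have hu' : a • latticeEmb u = (t * (1 - a)) • latticeEmb u := by rw [ht]
      rw [hq, hz, hu']
      module
    · intro h0
      rw [h0, Int.cast_zero] at hdet
      exact mul_ne_zero ha1.ne' hD' hdet.symm
  rcases le_total a b with hab | hab <;> rcases le_total a c with hac | hac <;>
    rcases le_total b c with hbc | hbc
  all_goals first
    | exact min_first u v w a b c hu hv hw ha hb hc habc hz hD hN (by linarith) (by linarith)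
    | exact min_first v w u b c a hv hw hu hb hc ha (by linarith) (by rw [hz]; abel)
        (by rwa [triangleDet_rotate]) (by rwa [triangleDet_rotate]) (by linarith) (by linarith)
    | exact min_first w u v c a b hw hu hv hc ha hb (by linarith) (by rw [hz]; abel)
        (by rwa [← triangleDet_rotate]) (by rwa [← triangleDet_rotate]) (by linarith)
        (by linarith)

lemma triangleDet_ne_zero_of_affineIndependent {v : Fin 3 → ℤ × ℤ}
    (h : AffineIndependent ℝ (latticeEmb ∘ v)) : triangleDet (v 0) (v 1) (v 2) ≠ 0 := by
  intro h0
  have h0' : (((v 1).1 : ℝ) - (v 0).1) * ((v 2).2 - (v 0).2)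
      - ((v 1).2 - (v 0).2) * ((v 2).1 - (v 0).1) = 0 := by
    exact_mod_cast h0
  have rel : ∀ s t : ℝ, s * ((v 1).1 - (v 0).1) + t * ((v 2).1 - (v 0).1) = 0 →
      s * ((v 1).2 - (v 0).2) + t * ((v 2).2 - (v 0).2) = 0 → s = 0 ∧ t = 0 := by
    intro s t h1 h2
    have := affineIndependent_iff.1 h Finset.univ ![-(s + t), s, t]
      (by simp [Fin.sum_univ_three])
      (by
        simp only [Fin.sum_univ_three, latticeEmb, Function.comp, Prod.ext_iff, Prod.fst_add,
          Prod.snd_add, Prod.smul_fst, Prod.smul_snd, smul_eq_mul, Prod.fst_zero, Prod.snd_zero,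
          Matrix.cons_val]
        constructor <;> linarith)
    exact ⟨by simpa using this 1 (Finset.mem_univ _), by simpa using this 2 (Finset.mem_univ _)⟩
  obtain ⟨h1, h2⟩ := rel ((v 2).2 - (v 0).2) (-((v 1).2 - (v 0).2)) (by linarith) (by ring)
  obtain ⟨h3, h4⟩ := rel (-((v 2).1 - (v 0).1)) ((v 1).1 - (v 0).1) (by ring) (by linarith)
  exact one_ne_zero (rel 1 0 (by linarith) (by linarith)).1

/-- One can split off a lattice point of a lattice polygon from any lattice point of its
`(n + 1)`-st dilate. -/
lemma exists_lattice_sub_mem_smul {S : Set (ℤ × ℤ)} {n : ℕ} (hn : 1 ≤ n) {z : ℤ × ℤ}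
    (hz : latticeEmb z ∈ ((n + 1 : ℕ) : ℝ) • convexHull ℝ (latticeEmb '' S)) :
    ∃ p : ℤ × ℤ, latticeEmb p ∈ convexHull ℝ (latticeEmb '' S) ∧
      latticeEmb (z - p) ∈ (n : ℝ) • convexHull ℝ (latticeEmb '' S) := by
  set P := convexHull ℝ (latticeEmb '' S) with hPdef
  have hP : Convex ℝ P := convex_convexHull ℝ _
  obtain ⟨y, hy, hzy⟩ := Set.mem_smul_set.1 hz
  obtain ⟨ι, _, v, c, hvS, hv, hc, hc1, rfl⟩ := eq_pos_convex_span_of_mem_convexHull hy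
  have hvP : ∀ i, v i ∈ P := fun i => subset_convexHull ℝ _ (hvS ⟨i, rfl⟩)
  choose q _ hqv using fun i => hvS ⟨i, rfl⟩
  obtain rfl : latticeEmb ∘ q = v := funext hqv
  have hn0 : (0 : ℝ) < n := by exact_mod_cast hn
  push_cast at hzy
  by_cases hbig : ∃ i, 1 ≤ ((n : ℝ) + 1) * c i
  · classical
    obtain ⟨i, hi⟩ := hbig
    refine ⟨q i, hvP i, Set.mem_smul_set.2
      ⟨∑ j, ((n : ℝ)⁻¹ * ((n + 1) * c j - if j = i then 1 else 0)) • (latticeEmb ∘ q) j,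
        hP.sum_mem ?_ ?_ (fun j _ => hvP j), ?_⟩⟩
    · intro j _
      refine mul_nonneg (by positivity) (sub_nonneg.2 ?_)
      split_ifs with hji
      · exact hji ▸ hi
      · have := hc j
        positivity
    · rw [← Finset.mul_sum, Finset.sum_sub_distrib, ← Finset.mul_sum, hc1]
      simp [hn0.ne']
    · rw [latticeEmb_sub, ← hzy]
      simp only [mul_smul, ← Finset.smul_sum, smul_inv_smul₀ hn0.ne', sub_smul,
        Finset.sum_sub_distrib]
      simp
  · push Not at hbig
    have hsum : ∑ i, ((n : ℝ) + 1) * c i = n + 1 := by rw [← Finset.mul_sum, hc1, mul_one]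
    have hne : (Finset.univ : Finset ι).Nonempty := by
      by_contra hne
      rw [Finset.not_nonempty_iff_eq_empty.1 hne] at hc1
      simp at hc1
    have hlt : (n : ℝ) + 1 < Fintype.card ι := by
      rw [← hsum]
      refine (Finset.sum_lt_sum_of_nonempty hne fun i _ => hbig i).trans_eq ?_
      simp
    have hlt' : n + 1 < Fintype.card ι := by exact_mod_cast hlt
    have hle : Fintype.card ι ≤ 3 := by
      refine hv.card_le_finrank_succ.trans (Nat.succ_le_succ ((Submodule.finrank_le _).trans ?_))
      simp
    obtain rfl : n = 1 := by omega
    have e : Fin 3 ≃ ι := (Fintype.equivFinOfCardEq (by omega)).symm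
    rw [← e.sum_comp, Fin.sum_univ_three] at hc1
    rw [← e.sum_comp, Fin.sum_univ_three] at hzy
    have hdet := triangleDet_ne_zero_of_affineIndependent (v := q ∘ e)
      (hv.comp_embedding e.toEmbedding)
    have hnonneg : ∀ i, 0 ≤ 2 * c i := fun i => mul_nonneg zero_le_two (hc i).le
    obtain ⟨p, hp, hzp⟩ := exists_lattice_sub_mem_of_triangle hP z _ _ _ (2 * c (e 0))
      (2 * c (e 1)) (2 * c (e 2)) (hvP (e 0)) (hvP (e 1)) (hvP (e 2)) (hnonneg _) (hnonneg _)
      (hnonneg _) (by linarith)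
      (by
        rw [← hzy]
        simp only [Function.comp, Nat.cast_one]
        module) hdet
    exact ⟨p, hp, by simpa using hzp⟩

lemma exists_lattice_sum_of_mem_smul {S : Set (ℤ × ℤ)} {n : ℕ} (hn : 1 ≤ n) {z : ℤ × ℤ}
    (hz : latticeEmb z ∈ (n : ℝ) • convexHull ℝ (latticeEmb '' S)) :
    ∃ p : Fin n → ℝ × ℝ, (∀ i, p i ∈ convexHull ℝ (latticeEmb '' S) ∧
      ∃ w : ℤ × ℤ, p i = latticeEmb w) ∧ latticeEmb z = ∑ i, p i := by
  induction n, hn using Nat.le_induction generalizing z with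
  | base => exact ⟨fun _ => latticeEmb z, fun _ => ⟨by simpa using hz, z, rfl⟩, by simp⟩
  | succ n hn ih =>
    obtain ⟨w, hw, hzw⟩ := exists_lattice_sub_mem_smul hn hz
    obtain ⟨p, hp, hsum⟩ := ih hzw
    refine ⟨Fin.cons (latticeEmb w) p, Fin.cases ⟨hw, w, rfl⟩ hp, ?_⟩
    rw [Fin.sum_cons, ← hsum, latticeEmb_sub]
    abel

lemma Convex.sum_fin_mem_smul {P : Set (ℝ × ℝ)} (hP : Convex ℝ P) {n : ℕ} (hn : 1 ≤ n)
    {p : Fin n → ℝ × ℝ} (hp : ∀ i, p i ∈ P) : ∑ i, p i ∈ (n : ℝ) • P := by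
  have hn0 : (n : ℝ) ≠ 0 := by exact_mod_cast (by omega : n ≠ 0)
  refine Set.mem_smul_set.2 ⟨∑ i, (n : ℝ)⁻¹ • p i, hP.sum_mem (fun _ _ => by positivity) ?_
    (fun i _ => hp i), ?_⟩
  · simp [hn0]
  · rw [← Finset.smul_sum, smul_inv_smul₀ hn0]

/-- **Normality of lattice polygons.** For a nonempty finite set `S ⊆ ℤ²` with convex hull
`P = conv(S) ⊆ ℝ²` and any integer `n ≥ 1`, the lattice points of the dilate `n • P` are
exactly the sums of `n` lattice points of `P`. -/
theorem lattice_polygon_normal (S : Finset (ℤ × ℤ)) (hS : S.Nonempty)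
    (P : Set (ℝ × ℝ))
    (hP : P = convexHull ℝ ((fun z : ℤ × ℤ => ((z.1 : ℝ), (z.2 : ℝ))) '' (S : Set (ℤ × ℤ))))
    (n : ℕ) (hn : 1 ≤ n) :
    ((n : ℝ) • P) ∩ {x : ℝ × ℝ | ∃ z : ℤ × ℤ, x = ((z.1 : ℝ), (z.2 : ℝ))} =
      {x : ℝ × ℝ | ∃ p : Fin n → ℝ × ℝ,
        (∀ i, p i ∈ P ∧ ∃ z : ℤ × ℤ, p i = ((z.1 : ℝ), (z.2 : ℝ))) ∧ x = ∑ i, p i} := by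
  subst hP
  ext x
  constructor
  · rintro ⟨hx, z, rfl⟩
    exact exists_lattice_sum_of_mem_smul hn hx
  · rintro ⟨p, hp, rfl⟩
    refine ⟨(convex_convexHull ℝ _).sum_fin_mem_smul hn fun i => (hp i).1, ?_⟩
    choose z hz using fun i => (hp i).2
    refine ⟨∑ i, z i, ?_⟩
    simp only [hz]
    ext <;> simp [Prod.fst_sum, Prod.snd_sum]
end

section
/- Let S ⊆ ℤ² be a nonempty finite set, let P = conv(S) ⊆ ℝ² be its convex hull, and let C ⊆ ℝ³ be the conical hull of P × {1}, i.e. the set of all finite nonnegative linear combinations of elements of P × {1}. Then for every integer n ≥ 1 and every x ∈ ℤ² with (x, n) ∈ C, there exist lattice points p₁, …, pₙ ∈ P ∩ ℤ² such that (x, n) = (p₁, 1) + ⋯ + (pₙ, 1). In other words, the affine semigroup C ∩ ℤ³, graded by the last coordinate, is generated by its degree-one part (P ∩ ℤ²) × {1}. -/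
open Pointwise

/-- The inclusion of the lattice `ℤ²` into `ℝ²`. -/
def latticeInclusion (z : ℤ × ℤ) : ℝ × ℝ := ((z.1 : ℝ), (z.2 : ℝ))

theorem Convex.add_smul_three_mem {P : Set (ℝ × ℝ)} (hP : Convex ℝ P) {u v w : ℝ × ℝ}
    (hu : u ∈ P) (hv : v ∈ P) (hw : w ∈ P) {α β γ : ℝ} (hα : 0 ≤ α) (hβ : 0 ≤ β) (hγ : 0 ≤ γ)
    (h : α + β + γ = 1) : α • u + β • v + γ • w ∈ P := by
  have := hP.sum_mem (t := Finset.univ) (w := ![α, β, γ]) (z := ![u, v, w])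
    (by intro i _; fin_cases i <;> simpa) (by simpa [Fin.sum_univ_three] using h)
    (by intro i _; fin_cases i <;> simpa)
  simpa [Fin.sum_univ_three] using this

/-- Twice the signed area of the lattice triangle `a b c`. -/
def latticeTriangleDet (a b c : ℤ × ℤ) : ℤ :=
  (b.1 - a.1) * (c.2 - a.2) - (b.2 - a.2) * (c.1 - a.1)

/-- A lattice point of the second dilate of a nondegenerate lattice triangle is the sum of two
lattice points of the triangle. -/
theorem exists_add_of_mem_two_smul_triangle {P : Set (ℝ × ℝ)} (hP : Convex ℝ P)
    (a b c x : ℤ × ℤ) (α β γ : ℝ)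
    (ha : latticeInclusion a ∈ P) (hb : latticeInclusion b ∈ P) (hc : latticeInclusion c ∈ P)
    (hα : 0 ≤ α) (hβ : 0 ≤ β) (hγ : 0 ≤ γ) (hsum : α + β + γ = 2)
    (hx : latticeInclusion x =
      α • latticeInclusion a + β • latticeInclusion b + γ • latticeInclusion c)
    (hD : latticeTriangleDet a b c ≠ 0) :
    ∃ p q : ℤ × ℤ, latticeInclusion p ∈ P ∧ latticeInclusion q ∈ P ∧ x = p + q := by
  induction hd : (latticeTriangleDet a b c).natAbs using Nat.strong_induction_on
    generalizing a b c α β γ with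
  | _ d ih =>
  have key : ∀ (a b c : ℤ × ℤ) (α β γ : ℝ), latticeInclusion a ∈ P → latticeInclusion b ∈ P →
      latticeInclusion c ∈ P → 0 ≤ α → α + β + γ = 2 →
      latticeInclusion x =
        α • latticeInclusion a + β • latticeInclusion b + γ • latticeInclusion c →
      latticeTriangleDet a b c ≠ 0 → (latticeTriangleDet a b c).natAbs = d →
      α ≤ β → α ≤ γ → β < 1 → γ < 1 →
      ∃ p q : ℤ × ℤ, latticeInclusion p ∈ P ∧ latticeInclusion q ∈ P ∧ x = p + q := by
    clear! a b c α β γ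
    intro a b c α β γ ha hb hc hα hsum hx hD hd hαβ hαγ hβ hγ
    have hα0 : 0 < α := by linarith
    have hα1 : 0 < 1 - α := by linarith
    have hy : latticeInclusion (a + b + c - x) = (1 - α) • latticeInclusion a +
        (1 - β) • latticeInclusion b + (1 - γ) • latticeInclusion c := by
      simp only [latticeInclusion, Prod.ext_iff, Prod.fst_add, Prod.snd_add, Prod.smul_fst,
        Prod.smul_snd, Prod.fst_sub, Prod.snd_sub, smul_eq_mul] at hx ⊢
      push_cast
      constructor <;> linarith [hx.1, hx.2]
    have hyP : latticeInclusion (a + b + c - x) ∈ P := by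
      rw [hy]
      exact hP.add_smul_three_mem ha hb hc (by linarith) (by linarith) (by linarith)
        (by linarith)
    have hdet : (latticeTriangleDet (a + b + c - x) b c : ℝ) =
        (1 - α) * latticeTriangleDet a b c := by
      simp only [latticeInclusion, Prod.ext_iff, Prod.fst_add, Prod.snd_add, Prod.smul_fst,
        Prod.smul_snd, smul_eq_mul] at hx
      obtain ⟨h1, h2⟩ := hx
      obtain rfl : γ = 2 - α - β := by linarith
      simp only [latticeTriangleDet, Prod.fst_add, Prod.snd_add, Prod.fst_sub, Prod.snd_sub]
      push_cast
      rw [h1, h2]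
      ring
    have hDR : (latticeTriangleDet a b c : ℝ) ≠ 0 := by exact_mod_cast hD
    refine ih _ ?_ (a + b + c - x) b c (α / (1 - α)) ((β - α) / (1 - α)) ((γ - α) / (1 - α))
      hyP hb hc (by positivity) (div_nonneg (by linarith) hα1.le)
      (div_nonneg (by linarith) hα1.le) ?_ ?_ ?_ rfl
    · rw [← hd]
      have : |(latticeTriangleDet (a + b + c - x) b c : ℝ)| < |(latticeTriangleDet a b c : ℝ)| := by
        rw [hdet, abs_mul, abs_of_pos hα1]
        nlinarith [abs_pos.2 hDR]
      have h : |latticeTriangleDet (a + b + c - x) b c| < |latticeTriangleDet a b c| := by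
        exact_mod_cast this
      zify
      exact h
    · field_simp
      linarith
    · rw [hy, hx]
      simp only [Prod.ext_iff, Prod.fst_add, Prod.snd_add, Prod.smul_fst,
        Prod.smul_snd, smul_eq_mul]
      constructor <;> field_simp <;> ring
    · intro h0
      rw [h0, Int.cast_zero] at hdet
      exact (mul_ne_zero hα1.ne' hDR) hdet.symm
  have peel : ∀ (a b c : ℤ × ℤ) (α β γ : ℝ), latticeInclusion a ∈ P → latticeInclusion b ∈ P →
      latticeInclusion c ∈ P → 1 ≤ α → 0 ≤ β → 0 ≤ γ → α + β + γ = 2 →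
      latticeInclusion x =
        α • latticeInclusion a + β • latticeInclusion b + γ • latticeInclusion c →
      ∃ p q : ℤ × ℤ, latticeInclusion p ∈ P ∧ latticeInclusion q ∈ P ∧ x = p + q := by
    clear! a b c α β γ
    intro a b c α β γ ha hb hc hα hβ hγ hsum hx
    refine ⟨a, x - a, ha, ?_, by abel⟩
    have : latticeInclusion (x - a) = (α - 1) • latticeInclusion a + β • latticeInclusion b +
        γ • latticeInclusion c := by
      simp only [latticeInclusion, Prod.ext_iff, Prod.fst_add, Prod.snd_add, Prod.smul_fst,
        Prod.smul_snd, Prod.fst_sub, Prod.snd_sub, smul_eq_mul] at hx ⊢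
      push_cast
      constructor <;> linarith [hx.1, hx.2]
    rw [this]
    exact hP.add_smul_three_mem ha hb hc (by linarith) hβ hγ (by linarith)
  have hcyc : latticeTriangleDet b c a = latticeTriangleDet a b c := by
    simp only [latticeTriangleDet]; ring
  have hcyc' : latticeTriangleDet c a b = latticeTriangleDet a b c := by
    simp only [latticeTriangleDet]; ring
  have hx' : latticeInclusion x =
      β • latticeInclusion b + γ • latticeInclusion c + α • latticeInclusion a := by
    rw [hx]; abel
  have hx'' : latticeInclusion x =
      γ • latticeInclusion c + α • latticeInclusion a + β • latticeInclusion b := by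
    rw [hx]; abel
  rcases le_or_gt 1 α with h1 | h1
  · exact peel a b c α β γ ha hb hc h1 hβ hγ hsum hx
  rcases le_or_gt 1 β with h2 | h2
  · exact peel b c a β γ α hb hc ha h2 hγ hα (by linarith) hx'
  rcases le_or_gt 1 γ with h3 | h3
  · exact peel c a b γ α β hc ha hb h3 hα hβ (by linarith) hx''
  by_cases h : α ≤ β ∧ α ≤ γ
  · exact key a b c α β γ ha hb hc hα hsum hx hD hd h.1 h.2 h2 h3
  by_cases h' : β ≤ γ ∧ β ≤ α
  · exact key b c a β γ α hb hc ha hβ (by linarith) hx' (hcyc ▸ hD) (hcyc ▸ hd) h'.1 h'.2 h3 h1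
  · exact key c a b γ α β hc ha hb hγ (by linarith) hx'' (hcyc' ▸ hD) (hcyc' ▸ hd)
      (by grind) (by grind) h1 h2

theorem latticeTriangleDet_ne_zero {a b c : ℤ × ℤ}
    (h : AffineIndependent ℝ ![latticeInclusion a, latticeInclusion b, latticeInclusion c]) :
    latticeTriangleDet a b c ≠ 0 := by
  intro h0
  have hrel : ∀ β γ : ℤ, β * (b.1 - a.1) + γ * (c.1 - a.1) = 0 →
      β * (b.2 - a.2) + γ * (c.2 - a.2) = 0 → β = 0 ∧ γ = 0 := by
    intro β γ e1 e2
    have e1' : (β : ℝ) * (b.1 - a.1) + γ * (c.1 - a.1) = 0 := by exact_mod_cast e1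
    have e2' : (β : ℝ) * (b.2 - a.2) + γ * (c.2 - a.2) = 0 := by exact_mod_cast e2
    have hw := (affineIndependent_iff.1 h) Finset.univ ![-(β : ℝ) - γ, (β : ℝ), (γ : ℝ)]
      (by simp [Fin.sum_univ_three]; ring)
      (by
        simp only [Fin.sum_univ_three, latticeInclusion, Prod.ext_iff, Matrix.cons_val,
          Prod.fst_add, Prod.snd_add, Prod.smul_fst, Prod.smul_snd, smul_eq_mul, Prod.fst_zero,
          Prod.snd_zero]
        constructor <;> linarith)
    exact ⟨by simpa using hw 1 (Finset.mem_univ _), by simpa using hw 2 (Finset.mem_univ _)⟩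
  unfold latticeTriangleDet at h0
  have h2 := hrel (c.2 - a.2) (-(b.2 - a.2)) (by linarith) (by ring)
  have h1 := hrel (c.1 - a.1) (-(b.1 - a.1)) (by ring) (by linarith)
  exact one_ne_zero (hrel 1 0 (by linarith [h1.2]) (by linarith [h2.2])).1

/-- A lattice point of the `n`-th dilate of a lattice simplex of dimension at most two is the sum
of `n` lattice points of the simplex. -/
theorem exists_sum_of_mem_nsmul_simplex {P : Set (ℝ × ℝ)} (hP : Convex ℝ P)
    {ι : Type*} [Fintype ι] (v : ι → ℤ × ℤ) (hv : ∀ i, latticeInclusion (v i) ∈ P)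
    (hind : AffineIndependent ℝ fun i => latticeInclusion (v i)) (hcard : Fintype.card ι ≤ 3)
    (n : ℕ) (w : ι → ℝ) (hw : ∀ i, 0 ≤ w i) (hsum : ∑ i, w i = n) (x : ℤ × ℤ)
    (hx : latticeInclusion x = ∑ i, w i • latticeInclusion (v i)) :
    ∃ p : Fin n → ℤ × ℤ, (∀ i, latticeInclusion (p i) ∈ P) ∧ x = ∑ i, p i := by
  classical
  induction n generalizing w x with
  | zero =>
    have hw0 : ∀ i, w i = 0 := by
      simpa [Finset.sum_eq_zero_iff_of_nonneg fun i _ => hw i] using hsum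
    refine ⟨Fin.elim0, fun i => i.elim0, ?_⟩
    simpa [hw0, latticeInclusion, Prod.ext_iff] using hx
  | succ n ih =>
    by_cases hbig : ∃ j, 1 ≤ w j
    · obtain ⟨j, hj⟩ := hbig
      obtain ⟨p, hp, hxp⟩ := ih (fun i => w i - if i = j then 1 else 0)
        (fun i => by
          split_ifs with h
          · subst h; linarith
          · simpa using hw i)
        (by simp [Finset.sum_sub_distrib, hsum]) (x - v j)
        (by
          simp only [sub_smul, Finset.sum_sub_distrib, ite_smul, one_smul, zero_smul,
            Finset.sum_ite_eq', Finset.mem_univ, if_true, ← hx]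
          simp [latticeInclusion])
      refine ⟨Fin.cons (v j) p, Fin.cases (by simpa using hv j) (by simpa using hp), ?_⟩
      rw [Fin.sum_univ_succ]
      simp [← hxp]
    · push Not at hbig
      have hne : (Finset.univ : Finset ι).Nonempty := by
        rw [Finset.nonempty_iff_ne_empty]
        intro h
        rw [h, Finset.sum_empty] at hsum
        exact (Nat.cast_ne_zero.2 n.succ_ne_zero) hsum.symm
      have hlt : n + 1 < Fintype.card ι := by
        have := Finset.sum_lt_sum_of_nonempty hne fun i _ => hbig i
        rw [hsum] at this
        simp only [Finset.sum_const, nsmul_eq_mul, mul_one, Finset.card_univ] at this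
        exact_mod_cast this
      obtain rfl | rfl : n = 0 ∨ n = 1 := by omega
      · refine ⟨fun _ => x, fun _ => ?_, by simp⟩
        rw [hx]
        exact hP.sum_mem (fun i _ => hw i) (by simpa using hsum) fun i _ => hv i
      · have e : Fin 3 ≃ ι := (Fintype.equivFinOfCardEq (by omega)).symm
        rw [← e.sum_comp, Fin.sum_univ_three] at hsum hx
        have hind' : AffineIndependent ℝ ![latticeInclusion (v (e 0)), latticeInclusion (v (e 1)),
            latticeInclusion (v (e 2))] := by
          convert hind.comp_embedding e.toEmbedding using 1
          ext i <;> fin_cases i <;> rfl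
        obtain ⟨p, q, hp, hq, hpq⟩ := exists_add_of_mem_two_smul_triangle hP _ _ _ x _ _ _
          (hv _) (hv _) (hv _) (hw _) (hw _) (hw _) (by rw [hsum]; norm_num) hx
          (latticeTriangleDet_ne_zero hind')
        exact ⟨![p, q], fun i => by fin_cases i <;> simpa, by simpa using hpq⟩


/-- **Degree-one generation of the semigroup of the cone.** Let `P = conv(S) ⊆ ℝ²` for a
nonempty finite `S ⊆ ℤ²` and let `C ⊆ ℝ³` be the conical hull of `P × {1}`. Then for every
integer `n ≥ 1` and every `x ∈ ℤ²` with `(x, n) ∈ C`, there are lattice points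
`p₁, …, pₙ ∈ P ∩ ℤ²` with `(x, n) = (p₁, 1) + ⋯ + (pₙ, 1)`. -/
theorem cone_semigroup_generated_in_degree_one (S : Finset (ℤ × ℤ)) (hS : S.Nonempty)
    (P : Set (ℝ × ℝ))
    (hP : P = convexHull ℝ ((fun z : ℤ × ℤ => ((z.1 : ℝ), (z.2 : ℝ))) '' (S : Set (ℤ × ℤ))))
    (C : Set (ℝ × ℝ × ℝ))
    (hC : C = {y : ℝ × ℝ × ℝ | ∃ (k : ℕ) (c : Fin k → ℝ) (q : Fin k → ℝ × ℝ),
      (∀ i, 0 ≤ c i ∧ q i ∈ P) ∧ y = ∑ i, c i • ((q i).1, (q i).2, (1 : ℝ))})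
    (n : ℕ) (hn : 1 ≤ n) (x : ℤ × ℤ)
    (hx : ((x.1 : ℝ), (x.2 : ℝ), (n : ℝ)) ∈ C) :
    ∃ p : Fin n → ℤ × ℤ,
      (∀ i, (((p i).1 : ℝ), ((p i).2 : ℝ)) ∈ P) ∧ x = ∑ i, p i := by
  have hPc : Convex ℝ P := hP ▸ convex_convexHull ℝ _
  have hn0 : (0 : ℝ) < n := by exact_mod_cast hn
  rw [hC] at hx
  obtain ⟨k, c, q, hcq, hy⟩ := hx
  simp only [Prod.ext_iff, Prod.fst_sum, Prod.snd_sum, Prod.smul_fst, Prod.smul_snd,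
    smul_eq_mul, mul_one] at hy
  obtain ⟨hy1, hy2, hy3⟩ := hy
  have hmem : (n : ℝ)⁻¹ • latticeInclusion x ∈ P := by
    have := hPc.sum_mem (t := Finset.univ) (w := fun i => (n : ℝ)⁻¹ * c i) (z := q)
      (fun i _ => mul_nonneg (by positivity) (hcq i).1)
      (by rw [← Finset.mul_sum, ← hy3, inv_mul_cancel₀ hn0.ne']) fun i _ => (hcq i).2
    convert this using 1
    simp only [mul_smul, ← Finset.smul_sum]
    congr 1
    simp [latticeInclusion, Prod.ext_iff, Prod.fst_sum, Prod.snd_sum, hy1, hy2]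
  rw [hP] at hmem
  obtain ⟨ι, _, z, w, hz, hind, hw, hw1, hwz⟩ := eq_pos_convex_span_of_mem_convexHull hmem
  have hz' : ∀ i, ∃ s ∈ S, latticeInclusion s = z i := fun i => by
    simpa only [latticeInclusion, Set.mem_image, Finset.mem_coe] using hz (Set.mem_range_self i)
  choose v hvS hvz using hz'
  obtain rfl : (fun i => latticeInclusion (v i)) = z := funext hvz
  refine exists_sum_of_mem_nsmul_simplex hPc v (fun i => ?_) hind ?_ n (fun i => n * w i)
    (fun i => mul_nonneg hn0.le (hw i).le) (by rw [← Finset.mul_sum, hw1, mul_one]) x ?_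
  · rw [hP]
    exact subset_convexHull ℝ _ (Set.mem_image_of_mem _ (hvS i))
  · have := hind.card_le_finrank_succ
    have h2 := Submodule.finrank_le (vectorSpan ℝ (Set.range fun i => latticeInclusion (v i)))
    rw [Module.finrank_prod, Module.finrank_self] at h2
    omega
  · simp only [mul_smul, ← Finset.smul_sum]
    rw [hwz, smul_inv_smul₀ hn0.ne']
end

section
/- Let K be a field, let S ⊆ ℕ² be a nonempty finite set, and let P = conv(S) ⊆ ℝ² be its convex hull. In the polynomial ring K[s,t,u], the K-subalgebra generated by the monomials {s^i t^j u : (i,j) ∈ P ∩ ℤ²} equals the K-linear span of the set of monomials {s^a t^b u^n : n ∈ ℕ, (a,b) ∈ ℕ², (a,b) ∈ n•P}, where n•P = {n·p : p ∈ P}. -/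
open Pointwise MvPolynomial

/-- If `q = a v₀ + b v₁ + c v₂` is a lattice point of a nondegenerate lattice triangle contained in
a convex set `P`, then `v₀ + v₁ + v₂ - q` is the sum of two lattice points of `P`. -/
theorem exists_lattice_add_of_triangle {P : Set (ℝ × ℝ)} (hP : Convex ℝ P) (D : ℕ) :
    ∀ (x₀ y₀ x₁ y₁ x₂ y₂ x y : ℤ) (a b c : ℝ),
      ((x₁ - x₀) * (y₂ - y₀) - (x₂ - x₀) * (y₁ - y₀)).natAbs = D → D ≠ 0 →
      ((x₀ : ℝ), (y₀ : ℝ)) ∈ P → ((x₁ : ℝ), (y₁ : ℝ)) ∈ P → ((x₂ : ℝ), (y₂ : ℝ)) ∈ P →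
      0 ≤ a → 0 ≤ b → 0 ≤ c → a + b + c = 1 →
      (x : ℝ) = a * x₀ + b * x₁ + c * x₂ → (y : ℝ) = a * y₀ + b * y₁ + c * y₂ →
      ∃ i j k l : ℤ, ((i : ℝ), (j : ℝ)) ∈ P ∧ ((k : ℝ), (l : ℝ)) ∈ P ∧
        i + k = x₀ + x₁ + x₂ - x ∧ j + l = y₀ + y₁ + y₂ - y := by
  have comb : ∀ {u v w : ℝ × ℝ} {a b c : ℝ}, u ∈ P → v ∈ P → w ∈ P → 0 ≤ a → 0 ≤ b → 0 ≤ c →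
      a + b + c = 1 → a • u + b • v + c • w ∈ P := by
    intro u v w a b c hu hv hw ha hb hc h
    have := hP.sum_mem (t := Finset.univ) (w := ![a, b, c]) (z := ![u, v, w])
      (by intro i _; fin_cases i <;> simpa) (by simpa [Fin.sum_univ_three] using h)
      (by intro i _; fin_cases i <;> simpa)
    simpa [Fin.sum_univ_three] using this
  induction D using Nat.strong_induction_on with
  | _ D ih =>
  -- By symmetry it suffices to descend when the first coefficient exceeds one half.
  have large : ∀ (x₀ y₀ x₁ y₁ x₂ y₂ x y : ℤ) (a b c : ℝ),
      ((x₁ - x₀) * (y₂ - y₀) - (x₂ - x₀) * (y₁ - y₀)).natAbs = D → D ≠ 0 →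
      ((x₀ : ℝ), (y₀ : ℝ)) ∈ P → ((x₁ : ℝ), (y₁ : ℝ)) ∈ P → ((x₂ : ℝ), (y₂ : ℝ)) ∈ P →
      0 ≤ a → 0 ≤ b → 0 ≤ c → a + b + c = 1 →
      (x : ℝ) = a * x₀ + b * x₁ + c * x₂ → (y : ℝ) = a * y₀ + b * y₁ + c * y₂ → 1 / 2 < a →
      ∃ i j k l : ℤ, ((i : ℝ), (j : ℝ)) ∈ P ∧ ((k : ℝ), (l : ℝ)) ∈ P ∧
        i + k = x₀ + x₁ + x₂ - x ∧ j + l = y₀ + y₁ + y₂ - y := by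
    intro x₀ y₀ x₁ y₁ x₂ y₂ x y a b c hD hD0 h₀ h₁ h₂ ha hb hc habc hx hy h
    rcases (show a ≤ 1 by linarith).eq_or_lt with ha1 | ha1
    · have hb0 : b = 0 := by linarith
      have hc0 : c = 0 := by linarith
      subst ha1 hb0 hc0
      have hx' : x = x₀ := by exact_mod_cast (by linarith : (x : ℝ) = x₀)
      have hy' : y = y₀ := by exact_mod_cast (by linarith : (y : ℝ) = y₀)
      exact ⟨x₁, y₁, x₂, y₂, h₁, h₂, by rw [hx']; ring, by rw [hy']; ring⟩
    · have hq : ((x : ℝ), (y : ℝ)) ∈ P := by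
        have := comb h₀ h₁ h₂ ha hb hc habc
        simpa [hx, hy] using this
      have hdet : (((x₁ - x) * (y₂ - y) - (x₂ - x) * (y₁ - y) : ℤ) : ℝ) =
          a * (((x₁ - x₀) * (y₂ - y₀) - (x₂ - x₀) * (y₁ - y₀) : ℤ) : ℝ) := by
        obtain rfl : c = 1 - a - b := by linarith
        push_cast
        rw [hx, hy]
        ring
      have hDR : (0 : ℝ) < D := by exact_mod_cast Nat.pos_of_ne_zero hD0
      have hnat : ((((x₁ - x) * (y₂ - y) - (x₂ - x) * (y₁ - y)).natAbs : ℕ) : ℝ) = a * D := by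
        rw [← hD, Nat.cast_natAbs, Nat.cast_natAbs, Int.cast_abs, Int.cast_abs, hdet, abs_mul,
          abs_of_nonneg ha]
      have hapos : 0 < a := by linarith
      obtain ⟨i, j, k, l, hij, hkl, e₁, e₂⟩ := ih _ (by
          have : ((((x₁ - x) * (y₂ - y) - (x₂ - x) * (y₁ - y)).natAbs : ℕ) : ℝ) < D := by
            rw [hnat]; nlinarith
          exact_mod_cast this) x y x₁ y₁ x₂ y₂ (2 * x - x₀) (2 * y - y₀)
        (2 - 1 / a) (b / a) (c / a) rfl (by
          have : ((((x₁ - x) * (y₂ - y) - (x₂ - x) * (y₁ - y)).natAbs : ℕ) : ℝ) ≠ 0 := by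
            rw [hnat]; positivity
          exact_mod_cast this) hq h₁ h₂
        (by rw [sub_nonneg, div_le_iff₀ hapos]; linarith) (by positivity) (by positivity)
        (by field_simp; linarith)
        (by push_cast; field_simp; linear_combination hx)
        (by push_cast; field_simp; linear_combination hy)
      exact ⟨i, j, k, l, hij, hkl, by linarith, by linarith⟩
  intro x₀ y₀ x₁ y₁ x₂ y₂ x y a b c hD hD0 h₀ h₁ h₂ ha hb hc habc hx hy
  by_cases ha2 : 1 / 2 < a
  · exact large x₀ y₀ x₁ y₁ x₂ y₂ x y a b c hD hD0 h₀ h₁ h₂ ha hb hc habc hx hy ha2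
  by_cases hb2 : 1 / 2 < b
  · obtain ⟨i, j, k, l, hij, hkl, e₁, e₂⟩ := large x₁ y₁ x₂ y₂ x₀ y₀ x y b c a
      (by rw [← hD]; congr 1; ring) hD0 h₁ h₂ h₀ hb hc ha (by linarith) (by linarith)
      (by linarith) hb2
    exact ⟨i, j, k, l, hij, hkl, by linarith, by linarith⟩
  by_cases hc2 : 1 / 2 < c
  · obtain ⟨i, j, k, l, hij, hkl, e₁, e₂⟩ := large x₂ y₂ x₀ y₀ x₁ y₁ x y c a b
      (by rw [← hD]; congr 1; ring) hD0 h₂ h₀ h₁ hc ha hb (by linarith) (by linarith)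
      (by linarith) hc2
    exact ⟨i, j, k, l, hij, hkl, by linarith, by linarith⟩
  refine ⟨x, y, x₀ + x₁ + x₂ - 2 * x, y₀ + y₁ + y₂ - 2 * y, ?_, ?_, by ring, by ring⟩
  · have := comb h₀ h₁ h₂ ha hb hc habc
    simpa [hx, hy] using this
  · have := comb (a := 1 - 2 * a) (b := 1 - 2 * b) (c := 1 - 2 * c) h₀ h₁ h₂
      (by linarith) (by linarith) (by linarith) (by linarith)
    convert this using 1
    ext
    · push_cast
      simp [hx]
      ring
    · push_cast
      simp [hy]
      ring

/-- Three affinely independent points of the plane span a triangle of nonzero area. -/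
theorem AffineIndependent.det_ne_zero {z : Fin 3 → ℝ × ℝ} (hz : AffineIndependent ℝ z) :
    ((z 1).1 - (z 0).1) * ((z 2).2 - (z 0).2) - ((z 2).1 - (z 0).1) * ((z 1).2 - (z 0).2) ≠ 0 := by
  intro h
  rw [affineIndependent_iff] at hz
  have key : ∀ u v : ℝ, u * ((z 1).1 - (z 0).1) + v * ((z 2).1 - (z 0).1) = 0 →
      u * ((z 1).2 - (z 0).2) + v * ((z 2).2 - (z 0).2) = 0 → u = 0 ∧ v = 0 := by
    intro u v h₁ h₂
    have := hz Finset.univ ![-u - v, u, v] (by simp [Fin.sum_univ_three]; ring) (by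
      ext
      · simp [Fin.sum_univ_three]
        linarith
      · simp [Fin.sum_univ_three]
        linarith)
    exact ⟨by simpa using this 1 (Finset.mem_univ _), by simpa using this 2 (Finset.mem_univ _)⟩
  have h₁ := key ((z 2).2 - (z 0).2) (-((z 1).2 - (z 0).2)) (by linarith) (by ring)
  have h₂ := key ((z 2).1 - (z 0).1) (-((z 1).1 - (z 0).1)) (by ring) (by linarith)
  have h₃ := key 1 0 (by linarith [h₂.2]) (by linarith [h₁.2])
  exact one_ne_zero h₃.1

/-- A lattice point of `(n + 1) • P`, for `P` a lattice polygon and `n ≥ 1`, is the sum of a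
lattice point of `P` and a lattice point of `n • P`. -/
theorem exists_lattice_add_of_mem_smul_convexHull (S : Set (ℕ × ℕ)) (n : ℕ) (hn : 1 ≤ n)
    (a b : ℕ) (h : ((a : ℝ), (b : ℝ)) ∈ ((n + 1 : ℕ) : ℝ) •
      convexHull ℝ ((fun z : ℕ × ℕ => ((z.1 : ℝ), (z.2 : ℝ))) '' S)) :
    ∃ i j k l : ℕ,
      ((i : ℝ), (j : ℝ)) ∈ convexHull ℝ ((fun z : ℕ × ℕ => ((z.1 : ℝ), (z.2 : ℝ))) '' S) ∧
      ((k : ℝ), (l : ℝ)) ∈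
        (n : ℝ) • convexHull ℝ ((fun z : ℕ × ℕ => ((z.1 : ℝ), (z.2 : ℝ))) '' S) ∧
      i + k = a ∧ j + l = b := by
  set P := convexHull ℝ ((fun z : ℕ × ℕ => ((z.1 : ℝ), (z.2 : ℝ))) '' S) with hPdef
  have hP : Convex ℝ P := convex_convexHull ℝ _
  have hnonneg : ∀ p ∈ P, 0 ≤ p.1 ∧ 0 ≤ p.2 := by
    have : P ⊆ Set.Ici (0 : ℝ × ℝ) := convexHull_min (by
      rintro _ ⟨z, -, rfl⟩
      exact ⟨by simp, by simp⟩) (convex_Ici 0)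
    exact fun p hp => ⟨(this hp).1, (this hp).2⟩
  have hn0 : (0 : ℝ) < n := by exact_mod_cast hn
  -- It suffices to find the summands with integer coordinates.
  suffices H : ∃ i j k l : ℤ, ((i : ℝ), (j : ℝ)) ∈ P ∧ ((k : ℝ), (l : ℝ)) ∈ (n : ℝ) • P ∧
      i + k = a ∧ j + l = b by
    obtain ⟨i, j, k, l, hij, hkl, e₁, e₂⟩ := H
    have hi : (0 : ℝ) ≤ i ∧ (0 : ℝ) ≤ j := hnonneg _ hij
    obtain ⟨p, hp, hpe⟩ := hkl
    have hk : (0 : ℝ) ≤ k ∧ (0 : ℝ) ≤ l := by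
      have h₁ := congrArg Prod.fst hpe
      have h₂ := congrArg Prod.snd hpe
      simp only [Prod.smul_fst, Prod.smul_snd, smul_eq_mul] at h₁ h₂
      have := hnonneg p hp
      rw [← h₁, ← h₂]
      exact ⟨mul_nonneg hn0.le this.1, mul_nonneg hn0.le this.2⟩
    lift i to ℕ using (by exact_mod_cast hi.1)
    lift j to ℕ using (by exact_mod_cast hi.2)
    lift k to ℕ using (by exact_mod_cast hk.1)
    lift l to ℕ using (by exact_mod_cast hk.2)
    exact ⟨i, j, k, l, by simpa using hij, ⟨p, hp, by simpa using hpe⟩, by exact_mod_cast e₁,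
      by exact_mod_cast e₂⟩
  obtain ⟨x, hx, hxe⟩ := h
  obtain ⟨ι, _, z, w, hzS, hz, hw, hw1, hwx⟩ := eq_pos_convex_span_of_mem_convexHull hx
  have hzP : ∀ i, z i ∈ P := fun i => subset_convexHull ℝ _ (hzS ⟨i, rfl⟩)
  have hzlat : ∀ i, ∃ v : ℤ × ℤ, z i = ((v.1 : ℝ), (v.2 : ℝ)) := by
    intro i
    obtain ⟨v, -, hv⟩ := hzS ⟨i, rfl⟩
    exact ⟨((v.1 : ℤ), (v.2 : ℤ)), by rw [← hv]; simp⟩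
  have hsum : ∑ i, ((n + 1 : ℕ) * w i : ℝ) • z i = ((a : ℝ), (b : ℝ)) := by
    rw [← hxe, ← hwx]
    simp only [mul_smul, ← Finset.smul_sum]
  by_cases hlarge : ∃ i, 1 ≤ ((n + 1 : ℕ) : ℝ) * w i
  · classical
    obtain ⟨i, hi⟩ := hlarge
    obtain ⟨v, hv⟩ := hzlat i
    refine ⟨v.1, v.2, a - v.1, b - v.2, hv ▸ hzP i, ?_, by ring, by ring⟩
    refine ⟨∑ j, (((n + 1 : ℕ) * w j - if j = i then 1 else 0) / n : ℝ) • z j,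
      hP.sum_mem ?_ ?_ fun j _ => hzP j, ?_⟩
    · intro j _
      refine div_nonneg ?_ hn0.le
      split_ifs with hj
      · rw [hj]; linarith
      · have := (hw j).le
        simp only [sub_zero]
        positivity
    · rw [← Finset.sum_div, Finset.sum_sub_distrib, ← Finset.mul_sum, hw1]
      simp [hn0.ne']
    · have : ∀ j, (n : ℝ) • ((((n + 1 : ℕ) * w j - if j = i then 1 else 0) / n : ℝ) • z j) =
          ((n + 1 : ℕ) * w j : ℝ) • z j - if j = i then z j else 0 := by
        intro j
        rw [smul_smul, mul_div_cancel₀ _ hn0.ne', sub_smul]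
        split_ifs <;> simp
      simp only [Finset.smul_sum, this, Finset.sum_sub_distrib, hsum]
      simp [hv]
  · push Not at hlarge
    have hcard : Fintype.card ι ≤ 3 := by
      have := hz.card_le_finrank_succ
      have h2 := Submodule.finrank_le (vectorSpan ℝ (Set.range z))
      simp at h2
      omega
    have hne : (Finset.univ : Finset ι).Nonempty := by
      by_contra hne
      rw [Finset.not_nonempty_iff_eq_empty] at hne
      simp [hne] at hw1
    have hlt : ((n + 1 : ℕ) : ℝ) < Fintype.card ι := by
      have := Finset.sum_lt_sum_of_nonempty hne fun i _ => hlarge i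
      rw [← Finset.mul_sum, hw1] at this
      simpa using this
    have hlt' : n + 1 < Fintype.card ι := by exact_mod_cast hlt
    have hn1 : n = 1 := by omega
    have hc3 : Fintype.card ι = 3 := by omega
    subst hn1
    let e : Fin 3 ≃ ι := (Fintype.equivFinOfCardEq hc3).symm
    have hdet := AffineIndependent.det_ne_zero
      ((affineIndependent_equiv e).2 hz)
    rw [← e.sum_comp, Fin.sum_univ_three] at hw1 hsum
    obtain ⟨v₀, h₀⟩ := hzlat (e 0)
    obtain ⟨v₁, h₁⟩ := hzlat (e 1)
    obtain ⟨v₂, h₂⟩ := hzlat (e 2)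
    simp only [Function.comp_apply, h₀, h₁, h₂] at hdet hsum
    have hl := fun i => hlarge (e i)
    push_cast at hl hsum
    have s₁ := congrArg Prod.fst hsum
    have s₂ := congrArg Prod.snd hsum
    simp at s₁ s₂
    obtain ⟨i, j, k, l, hij, hkl, e₁, e₂⟩ := exists_lattice_add_of_triangle hP _
      v₀.1 v₀.2 v₁.1 v₁.2 v₂.1 v₂.2 (v₀.1 + v₁.1 + v₂.1 - a) (v₀.2 + v₁.2 + v₂.2 - b)
      (1 - (1 + 1) * w (e 0)) (1 - (1 + 1) * w (e 1)) (1 - (1 + 1) * w (e 2)) rfl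
      (by rw [Int.natAbs_ne_zero]; exact_mod_cast hdet)
      (h₀ ▸ hzP _) (h₁ ▸ hzP _) (h₂ ▸ hzP _)
      (by linarith [hl 0]) (by linarith [hl 1]) (by linarith [hl 2]) (by linarith)
      (by push_cast; linarith) (by push_cast; linarith)
    exact ⟨i, j, k, l, hij, by simpa using hkl, by linarith, by linarith⟩

/-- **The toric coordinate ring as a semigroup algebra.** For a field `K` and a nonempty
finite `S ⊆ ℕ²` with convex hull `P = conv(S) ⊆ ℝ²`, the `K`-subalgebra of `K[s,t,u]`
generated by the monomials `s^i t^j u` with `(i,j) ∈ P ∩ ℤ²` equals the `K`-linear span of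
all monomials `s^a t^b u^n` with `(a,b) ∈ n • P`. -/
theorem toric_coordinate_ring_eq_semigroup_algebra (K : Type*) [Field K]
    (S : Finset (ℕ × ℕ)) (hS : S.Nonempty)
    (P : Set (ℝ × ℝ))
    (hP : P = convexHull ℝ ((fun z : ℕ × ℕ => ((z.1 : ℝ), (z.2 : ℝ))) '' (S : Set (ℕ × ℕ)))) :
    Subalgebra.toSubmodule
      (Algebra.adjoin K {f : MvPolynomial (Fin 3) K | ∃ i j : ℕ,
        ((i : ℝ), (j : ℝ)) ∈ P ∧ f = X 0 ^ i * X 1 ^ j * X 2}) =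
    Submodule.span K {f : MvPolynomial (Fin 3) K | ∃ n a b : ℕ,
      ((a : ℝ), (b : ℝ)) ∈ (n : ℝ) • P ∧ f = X 0 ^ a * X 1 ^ b * X 2 ^ n} := by
  have hconv : Convex ℝ P := hP ▸ convex_convexHull ℝ _
  have hne : P.Nonempty := by
    rw [hP, convexHull_nonempty_iff]
    exact (Finset.coe_nonempty.2 hS).image _
  apply le_antisymm
  · rw [Algebra.adjoin_eq_span]
    refine Submodule.span_mono fun f hf => ?_
    induction hf using Submonoid.closure_induction with
    | mem f hf =>
      obtain ⟨i, j, hij, rfl⟩ := hf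
      exact ⟨1, i, j, by simpa using hij, by simp⟩
    | one => exact ⟨0, 0, 0, by simp [Set.zero_smul_set hne], by simp⟩
    | mul f g _ _ hf hg =>
      obtain ⟨n, a, b, h, rfl⟩ := hf
      obtain ⟨m, c, d, h', rfl⟩ := hg
      refine ⟨n + m, a + c, b + d, ?_, by ring⟩
      rw [Nat.cast_add n m, hconv.add_smul n.cast_nonneg m.cast_nonneg]
      exact ⟨_, h, _, h', by simp⟩
  · rw [Submodule.span_le]
    rintro f ⟨n, a, b, h, rfl⟩
    rw [SetLike.mem_coe, Subalgebra.mem_toSubmodule]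
    induction n using Nat.strong_induction_on generalizing a b with
    | _ n ih =>
    match n, h, ih with
    | 0, h, _ =>
      rw [Nat.cast_zero, Set.zero_smul_set hne, Set.mem_zero, Prod.mk_eq_zero] at h
      obtain rfl : a = 0 := by exact_mod_cast h.1
      obtain rfl : b = 0 := by exact_mod_cast h.2
      simp
    | 1, h, _ => exact Algebra.subset_adjoin ⟨a, b, by simpa using h, by simp⟩
    | n + 2, h, ih =>
      rw [hP] at h
      obtain ⟨i, j, k, l, hij, hkl, rfl, rfl⟩ :=
        exists_lattice_add_of_mem_smul_convexHull _ (n + 1) (by omega) a b h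
      rw [← hP] at hij hkl
      have hsplit : (X 0 ^ (i + k) * X 1 ^ (j + l) * X 2 ^ (n + 2) : MvPolynomial (Fin 3) K) =
          X 0 ^ i * X 1 ^ j * X 2 * (X 0 ^ k * X 1 ^ l * X 2 ^ (n + 1)) := by ring
      rw [hsplit]
      exact mul_mem (Algebra.subset_adjoin ⟨i, j, hij, rfl⟩) (ih (n + 1) (by omega) k l hkl)
end
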